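/- arXiv:1609.05437 — 2 statements merged into one kernel-verified Lean document; each statement's English description precedes it below -/
import Mathlib

section
/- Let p > 1 and let Ω ⊂ ℝ^N be a bounded open set. Let ρ : Ω → [0, ∞) be bounded, let f satisfy condition (C) with s ↦ f(s)^{−1/(p−1)} integrable on (0, a) for every a ∈ (0, a_f), and let F(t) = ∫₀ᵗ f(s)^{−1/(p−1)} ds. Suppose u : cl(Ω) → ℝ is continuous, is C¹ on Ω with 0 < u(x) < a_f for x ∈ Ω and u = 0 on ∂Ω, its flux V_u is continuously differentiable on Ω, and div V_u(x) ≤ −ρ(x)f(u(x)) for all x ∈ Ω. Then for every x ∈ Ω and every y with ‖y − x‖ < d_Ω(x) one has F(u(y)) ≥ ((p−1)/p)·ρ_x(d_Ω(x))^{1/(p−1)}·(d_Ω(x)^{p/(p−1)} − ‖x − y‖^{p/(p−1)})/N^{1/(p−1)}. -/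
open Real Set Metric MeasureTheory

/-- The "flux" of `u` at `x`: `‖∇u(x)‖^(p-2) ∇u(x)` (equal to `0` when `∇u(x) = 0`,
by the junk-value conventions of `Real.rpow`, since `p ≠ 2` gives `0 ^ (p-2) = 0` and
for `p = 2` the scalar multiplies the zero vector). -/
noncomputable def flux {N : ℕ} (p : ℝ) (u : EuclideanSpace ℝ (Fin N) → ℝ)
    (x : EuclideanSpace ℝ (Fin N)) : EuclideanSpace ℝ (Fin N) :=
  ‖gradient u x‖ ^ (p - 2) • gradient u x

/-- The divergence of a vector field `V` at `x`: `∑ i, ∂V_i/∂x_i (x)`. -/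
noncomputable def pdiv {N : ℕ} (V : EuclideanSpace ℝ (Fin N) → EuclideanSpace ℝ (Fin N))
    (x : EuclideanSpace ℝ (Fin N)) : ℝ :=
  ∑ i : Fin N, fderiv ℝ V x (EuclideanSpace.single i 1) i

open Filter Topology

lemma IsLocalMin.nonneg_of_hasDerivAt_deriv {ψ ψ' : ℝ → ℝ} {m : ℝ} (hmin : IsLocalMin ψ 0)
    (hψ : ∀ᶠ t in 𝓝 0, HasDerivAt ψ (ψ' t) t) (hψ' : HasDerivAt ψ' m 0) : 0 ≤ m := by
  by_contra! hm
  have h0 : ψ' 0 = 0 := hmin.hasDerivAt_eq_zero hψ.self_of_nhds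
  have hslope := (hasDerivAt_iff_tendsto_slope.1 hψ').eventually (gt_mem_nhds hm)
  rw [eventually_nhdsWithin_iff] at hslope
  obtain ⟨δ, hδ, hball⟩ := Metric.eventually_nhds_iff.1 (hmin.and (hψ.and hslope))
  have hmem : ∀ t ∈ Icc 0 (δ / 2), dist t 0 < δ := fun t ht => by
    rw [Real.dist_eq, sub_zero, abs_of_nonneg ht.1]
    linarith [ht.2]
  have hδ2 : 0 < δ / 2 := by positivity
  obtain ⟨ξ, hξ, hξe⟩ := exists_hasDerivAt_eq_slope ψ ψ' hδ2
    (fun t ht => (hball (hmem t ht)).2.1.continuousAt.continuousWithinAt)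
    (fun t ht => (hball (hmem t (Ioo_subset_Icc_self ht))).2.1)
  have hneg := (hball (hmem ξ (Ioo_subset_Icc_self hξ))).2.2 (by simpa using hξ.1.ne')
  rw [slope_def_field, h0, sub_zero, sub_zero, div_neg_iff] at hneg
  have hψξ : ψ' ξ < 0 := by
    rcases hneg with h | h
    · exact absurd h.2 (not_lt.2 hξ.1.le)
    · exact h.1
  have hle := (hball (hmem (δ / 2) ⟨hδ2.le, le_rfl⟩)).1
  have : 0 ≤ (ψ (δ / 2) - ψ 0) / (δ / 2 - 0) := div_nonneg (by linarith) (by linarith)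
  linarith

lemma IsLocalMin.inner_nonneg_of_hasFDerivAt {E : Type*} [NormedAddCommGroup E]
    [InnerProductSpace ℝ E] {φ : E → ℝ} {G : E → E} {z : E} {L : E →L[ℝ] E}
    (hmin : IsLocalMin φ z) (hφ : ∀ᶠ y in 𝓝 z, HasFDerivAt φ (innerSL ℝ (G y)) y)
    (hG : HasFDerivAt G L z) (h : E) : 0 ≤ inner ℝ (L h) h := by
  have hline : ∀ t : ℝ, HasDerivAt (fun t : ℝ => z + t • h) h t := fun t => by
    simpa using ((hasDerivAt_id t).smul_const h).const_add z
  have hz : z + (0 : ℝ) • h = z := by simp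
  have hcont : ContinuousAt (fun t : ℝ => z + t • h) 0 := (hline 0).continuousAt
  refine IsLocalMin.nonneg_of_hasDerivAt_deriv (ψ := fun t : ℝ => φ (z + t • h))
    (ψ' := fun t : ℝ => inner ℝ (G (z + t • h)) h) ?_ ?_ ?_
  · exact IsLocalMin.comp_continuous (g := fun t : ℝ => z + t • h) (by rwa [hz]) hcont
  · have hev := hcont.eventually (p := fun y => HasFDerivAt φ (innerSL ℝ (G y)) y)
      (by simpa only [hz] using hφ)
    filter_upwards [hev] with t ht
    exact ht.comp_hasDerivAt t (hline t)
  · have hG' : HasFDerivAt G L (z + (0 : ℝ) • h) := by rwa [hz]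
    simpa using (hG'.comp_hasDerivAt 0 (hline 0)).inner ℝ (hasDerivAt_const (0 : ℝ) h)

lemma hasFDerivAt_norm_rpow_smul {E : Type*} [NormedAddCommGroup E] [InnerProductSpace ℝ E]
    (r : ℝ) {ζ : E} (hζ : ζ ≠ 0) :
    HasFDerivAt (fun v : E => ‖v‖ ^ r • v)
      (‖ζ‖ ^ r • ContinuousLinearMap.id ℝ E +
        ((r * ‖ζ‖ ^ (r - 2)) • innerSL ℝ ζ).smulRight ζ) ζ := by
  have hpos : 0 < ‖ζ‖ := norm_pos_iff.2 hζ
  have hsq : HasFDerivAt (fun v : E => ‖v‖ ^ r) ((r * ‖ζ‖ ^ (r - 2)) • innerSL ℝ ζ) ζ := by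
    have h1 := ((hasStrictFDerivAt_norm_sq ζ).hasFDerivAt).rpow_const (p := r / 2)
      (Or.inl (by positivity))
    have hfun : (fun v : E => (‖v‖ ^ 2) ^ (r / 2)) = fun v : E => ‖v‖ ^ r := by
      funext v
      rw [← Real.rpow_natCast, ← Real.rpow_mul (norm_nonneg v)]
      congr 1
      push_cast
      ring
    rw [hfun] at h1
    refine h1.congr_fderiv ?_
    have hexp : (‖ζ‖ ^ 2) ^ (r / 2 - 1) = ‖ζ‖ ^ (r - 2) := by
      rw [← Real.rpow_natCast, ← Real.rpow_mul (norm_nonneg ζ)]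
      congr 1
      push_cast
      ring
    rw [hexp]
    ext v
    simp
    ring
  exact hsq.smul (hasFDerivAt_id ζ)

lemma norm_rpow_smul_norm_rpow_smul {E : Type*} [NormedAddCommGroup E] [NormedSpace ℝ E]
    {r s : ℝ} (hrs : (1 + r) * (1 + s) = 1) (a : E) :
    ‖‖a‖ ^ r • a‖ ^ s • (‖a‖ ^ r • a) = a := by
  rcases eq_or_ne a 0 with rfl | ha
  · simp
  have hpos : 0 < ‖a‖ := norm_pos_iff.2 ha
  have hnorm : ‖‖a‖ ^ r • a‖ = ‖a‖ ^ (r + 1) := by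
    rw [norm_smul, Real.norm_of_nonneg (by positivity), Real.rpow_add hpos, Real.rpow_one]
  rw [hnorm, smul_smul, ← Real.rpow_mul hpos.le, ← Real.rpow_add hpos,
    show (r + 1) * s + r = 0 by linarith, Real.rpow_zero, one_smul]

lemma EuclideanSpace.sum_apply_single_eq_trace {ι : Type*} [Fintype ι] [DecidableEq ι]
    (T : EuclideanSpace ℝ ι →L[ℝ] EuclideanSpace ℝ ι) :
    ∑ i, T (EuclideanSpace.single i 1) i =
      LinearMap.trace ℝ _ (T : EuclideanSpace ℝ ι →ₗ[ℝ] EuclideanSpace ℝ ι) := by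
  rw [LinearMap.trace_eq_sum_inner _ (EuclideanSpace.basisFun ι ℝ)]
  exact Finset.sum_congr rfl fun i _ => by simp [EuclideanSpace.inner_single_left]

lemma trace_nonneg_of_inner_norm_rpow_smul_deriv_nonneg {E : Type*} [NormedAddCommGroup E]
    [InnerProductSpace ℝ E] [FiniteDimensional ℝ E] (T : E →L[ℝ] E) {r : ℝ} (hr : -1 < r)
    {ζ : E} (hζ : ζ ≠ 0)
    (h : ∀ b, 0 ≤ inner ℝ ((‖ζ‖ ^ r • ContinuousLinearMap.id ℝ E +
        ((r * ‖ζ‖ ^ (r - 2)) • innerSL ℝ ζ).smulRight ζ) (T b)) b) :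
    0 ≤ LinearMap.trace ℝ E (T : E →ₗ[ℝ] E) := by
  have hpos : 0 < ‖ζ‖ := norm_pos_iff.2 hζ
  set n : E := ‖ζ‖⁻¹ • ζ with hn
  have hn1 : ‖n‖ = 1 := by
    rw [hn, norm_smul, norm_inv, norm_norm, inv_mul_cancel₀ hpos.ne']
  have hζn : ζ = ‖ζ‖ • n := by rw [hn, smul_smul, mul_inv_cancel₀ hpos.ne', one_smul]
  have hon : Orthonormal ℝ (Subtype.val : ({n} : Set E) → E) := by
    classical
    rw [orthonormal_subtype_iff_ite]
    rintro v rfl w rfl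
    simp [hn1]
  obtain ⟨s, b, hns, hb⟩ := hon.exists_orthonormalBasis_extension
  rw [LinearMap.trace_eq_sum_inner _ b]
  refine Finset.sum_nonneg fun i _ => ?_
  have hi := h (b i)
  simp only [add_apply, smul_apply,
    ContinuousLinearMap.id_apply, ContinuousLinearMap.smulRight_apply, innerSL_apply_apply,
    inner_add_left, real_inner_smul_left, smul_eq_mul] at hi
  have hns' : n ∈ s := hns rfl
  have hbn : b ⟨n, hns'⟩ = n := by rw [hb]
  rw [real_inner_comm]
  simp only [ContinuousLinearMap.coe_coe]
  have hrpos : 0 < ‖ζ‖ ^ r := by positivity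
  by_cases hin : i = ⟨n, hns'⟩
  · rw [hin, hbn] at hi ⊢
    have hζT : inner ℝ ζ (T n) = ‖ζ‖ * inner ℝ (T n) n := by
      conv_lhs => rw [hζn, real_inner_smul_left, real_inner_comm]
    have hζζ : inner ℝ ζ n = ‖ζ‖ := by
      conv_lhs => rw [hζn, real_inner_smul_left, real_inner_self_eq_norm_sq, hn1]
      ring
    have hexp : ‖ζ‖ ^ (r - 2) * ‖ζ‖ * ‖ζ‖ = ‖ζ‖ ^ r := by
      rw [mul_assoc, ← sq, ← Real.rpow_natCast, ← Real.rpow_add hpos]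
      congr 1
      push_cast
      ring
    rw [hζT, hζζ] at hi
    have : 0 ≤ (‖ζ‖ ^ r * (1 + r)) * inner ℝ (T n) n := by
      calc 0 ≤ _ := hi
        _ = ‖ζ‖ ^ r * inner ℝ (T n) n
            + r * (‖ζ‖ ^ (r - 2) * ‖ζ‖ * ‖ζ‖) * inner ℝ (T n) n := by ring
        _ = _ := by rw [hexp]; ring
    exact nonneg_of_mul_nonneg_right this (mul_pos hrpos (by linarith))
  · have hort : inner ℝ ζ (b i) = 0 := by
      rw [hζn, real_inner_smul_left]
      conv_lhs => rw [← hbn]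
      rw [b.inner_eq_zero (Ne.symm hin), mul_zero]
    rw [hort, mul_zero, add_zero] at hi
    exact nonneg_of_mul_nonneg_right hi hrpos

/-- If `w` has gradient `‖W‖ ^ r • W` and is touched from below, away from `c`, by a translate of
the radial function `y ↦ -(k ^ (r + 1) / (r + 2)) * ‖y - c‖ ^ (r + 2)`, whose flux is
`-k • (y - c)`, then the divergence of `W` at the contact point is at least `-k * N`. -/
lemma IsLocalMin.neg_mul_le_sum_of_add_norm_rpow {N : ℕ}
    {w : EuclideanSpace ℝ (Fin N) → ℝ}
    {W : EuclideanSpace ℝ (Fin N) → EuclideanSpace ℝ (Fin N)}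
    {D : EuclideanSpace ℝ (Fin N) →L[ℝ] EuclideanSpace ℝ (Fin N)}
    {z c : EuclideanSpace ℝ (Fin N)} {r s k : ℝ} (hr : -1 < r) (hrs : (1 + r) * (1 + s) = 1)
    (hk : 0 < k) (hzc : z ≠ c)
    (hmin : IsLocalMin (fun y => w y + k ^ (r + 1) / (r + 2) * ‖y - c‖ ^ (r + 2)) z)
    (hw : ∀ᶠ y in 𝓝 z, HasFDerivAt w (innerSL ℝ (‖W y‖ ^ r • W y)) y)
    (hW : HasFDerivAt W D z) :
    -(k * N) ≤ ∑ i, D (EuclideanSpace.single i 1) i := by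
  have hgrad : ∀ᶠ y in 𝓝 z,
      HasFDerivAt (fun y => w y + k ^ (r + 1) / (r + 2) * ‖y - c‖ ^ (r + 2))
        (innerSL ℝ (‖W y‖ ^ r • W y - ‖(-k) • (y - c)‖ ^ r • (-k) • (y - c))) y := by
    filter_upwards [hw] with y hy
    have h2 := ((hasFDerivAt_norm_rpow (y - c) (show 1 < r + 2 by linarith)).comp y
      ((hasFDerivAt_id y).sub_const c)).const_mul (k ^ (r + 1) / (r + 2))
    refine (hy.add h2).congr_fderiv ?_
    ext v
    have hne : r + 2 ≠ 0 := by linarith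
    have hkr : k ^ (r + 1) = k ^ r * k := by rw [Real.rpow_add hk, Real.rpow_one]
    simp only [add_apply, smul_apply, smul_eq_mul,
      ContinuousLinearMap.comp_apply, ContinuousLinearMap.id_apply, innerSL_apply_apply,
      inner_sub_left, real_inner_smul_left, norm_smul, norm_neg, Real.norm_of_nonneg hk.le,
      Real.mul_rpow hk.le (norm_nonneg _), add_sub_cancel_right, hkr]
    field_simp
    ring
  have hP : HasFDerivAt (fun y => (-k) • (y - c))
      ((-k) • ContinuousLinearMap.id ℝ (EuclideanSpace ℝ (Fin N))) z :=
    ((hasFDerivAt_id z).sub_const c).const_smul (-k)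
  have hPz : (-k) • (z - c) ≠ 0 := smul_ne_zero (by linarith) (sub_ne_zero.2 hzc)
  have hWP : W z = (-k) • (z - c) := by
    have h0 := hmin.hasFDerivAt_eq_zero hgrad.self_of_nhds
    have h1 : ‖W z‖ ^ r • W z = ‖(-k) • (z - c)‖ ^ r • (-k) • (z - c) := by
      rw [← sub_eq_zero, ← inner_self_eq_zero (𝕜 := ℝ)]
      exact DFunLike.congr_fun h0 _
    rw [← norm_rpow_smul_norm_rpow_smul hrs (W z), h1, norm_rpow_smul_norm_rpow_smul hrs]
  have hB := hasFDerivAt_norm_rpow_smul r hPz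
  have hBW := (hWP ▸ hB : HasFDerivAt _ _ (W z)).comp z hW
  have hG := hBW.sub (hB.comp z hP)
  have htr := trace_nonneg_of_inner_norm_rpow_smul_deriv_nonneg
    (D - (-k) • ContinuousLinearMap.id ℝ (EuclideanSpace ℝ (Fin N))) hr hPz fun b => by
      have := IsLocalMin.inner_nonneg_of_hasFDerivAt hmin hgrad hG b
      simpa only [sub_apply, map_sub, ContinuousLinearMap.comp_apply, hWP]
        using this
  rw [← EuclideanSpace.sum_apply_single_eq_trace] at htr
  simp [Finset.sum_add_distrib] at htr
  linarith

/-- Comparison on a ball with the radial function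
`y ↦ k ^ (r + 1) / (r + 2) * (R ^ (r + 2) - ‖x - y‖ ^ (r + 2))`. Minimizing against all nearby translates of it reduces to contact points away from the
critical point of the comparison function. -/
lemma le_of_pdiv_lt {N : ℕ} {w : EuclideanSpace ℝ (Fin N) → ℝ}
    {W : EuclideanSpace ℝ (Fin N) → EuclideanSpace ℝ (Fin N)}
    {x : EuclideanSpace ℝ (Fin N)} {R r s k : ℝ} (hr : -1 < r) (hrs : (1 + r) * (1 + s) = 1)
    (hk : 0 < k) (hw0 : ∀ y ∈ ball x R, 0 ≤ w y)
    (hw : ∀ y ∈ ball x R, HasFDerivAt w (innerSL ℝ (‖W y‖ ^ r • W y)) y)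
    (hW : ∀ y ∈ ball x R, DifferentiableAt ℝ W y)
    (hdiv : ∀ y ∈ ball x R, pdiv W y < -(k * N)) {y : EuclideanSpace ℝ (Fin N)}
    (hy : y ∈ ball x R) :
    k ^ (r + 1) / (r + 2) * (R ^ (r + 2) - ‖x - y‖ ^ (r + 2)) ≤ w y := by
  have hr2 : 0 < r + 2 := by linarith
  set C := k ^ (r + 1) / (r + 2) with hC
  have hCpos : 0 < C := by positivity
  have hyR : ‖x - y‖ < R := by rwa [mem_ball', dist_eq_norm] at hy
  have hRpos : 0 < R := (norm_nonneg _).trans_lt hyR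
  have hxR : x ∈ ball x R := mem_ball_self hRpos
  have hrpow : Continuous fun t : ℝ => t ^ (r + 2) :=
    Real.continuous_rpow_const hr2.le
  suffices h : ∀ R' ∈ Ioo ‖x - y‖ R, C * (R' ^ (r + 2) - ‖x - y‖ ^ (r + 2)) ≤ w y by
    have hlim : Tendsto (fun R' : ℝ => C * (R' ^ (r + 2) - ‖x - y‖ ^ (r + 2))) (𝓝[<] R)
        (𝓝 (C * (R ^ (r + 2) - ‖x - y‖ ^ (r + 2)))) :=
      ((hrpow.sub continuous_const).const_mul C).continuousAt.tendsto.mono_left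
        nhdsWithin_le_nhds
    exact le_of_tendsto hlim (by filter_upwards [Ioo_mem_nhdsLT hyR] with R' hR' using h R' hR')
  rintro R' ⟨hyR', hR'R⟩
  by_contra! hlt
  have hsub : closedBall x R' ⊆ ball x R := closedBall_subset_ball hR'R
  have hyR'' : y ∈ closedBall x R' := by
    rw [mem_closedBall', dist_eq_norm]
    exact hyR'.le
  have hR'pos : 0 < R' := (norm_nonneg _).trans_lt hyR'
  have hev : ∀ᶠ c in 𝓝 x,
      w y + C * ‖y - c‖ ^ (r + 2) < C * (R' - ‖c - x‖) ^ (r + 2) := by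
    have h1 : Continuous fun c => w y + C * ‖y - c‖ ^ (r + 2) :=
      continuous_const.add
        ((hrpow.comp (continuous_const.sub continuous_id).norm).const_mul C)
    have h2 : Continuous fun c => C * (R' - ‖c - x‖) ^ (r + 2) :=
      (hrpow.comp (continuous_const.sub (continuous_id.sub continuous_const).norm)).const_mul C
    refine h1.continuousAt.eventually_lt h2.continuousAt ?_
    rw [sub_self, norm_zero, sub_zero, norm_sub_rev]
    linarith
  have hsmall : ∀ᶠ c in 𝓝 x, ‖c - x‖ < R' := by
    filter_upwards [Metric.ball_mem_nhds x hR'pos] with c hc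
    rwa [mem_ball, dist_eq_norm] at hc
  have hzero : ∀ᶠ c in 𝓝 x, W c = 0 := by
    filter_upwards [hev, hsmall] with c hc hcR
    have hcont : ContinuousOn (fun z => w z + C * ‖z - c‖ ^ (r + 2)) (closedBall x R') :=
      ContinuousOn.add (fun z hz => (hw z (hsub hz)).continuousAt.continuousWithinAt)
        ((hrpow.comp (continuous_id.sub continuous_const).norm).const_mul C).continuousOn
    obtain ⟨z, hz, hzmin⟩ := (isCompact_closedBall x R').exists_isMinOn ⟨y, hyR''⟩ hcont
    have hzball : z ∈ ball x R' := by
      by_contra hzn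
      have hzx : R' ≤ ‖z - x‖ := by rwa [mem_ball, not_lt, dist_eq_norm] at hzn
      have htri : R' - ‖c - x‖ ≤ ‖z - c‖ := by
        have := norm_sub_le_norm_sub_add_norm_sub z c x
        linarith
      have hle := Real.rpow_le_rpow (by linarith) htri hr2.le
      have h1 : w z + C * ‖z - c‖ ^ (r + 2) ≤ w y + C * ‖y - c‖ ^ (r + 2) := hzmin hyR''
      have h2 := mul_le_mul_of_nonneg_left hle hCpos.le
      linarith [hw0 z (hsub hz)]
    have hloc : IsLocalMin (fun z => w z + C * ‖z - c‖ ^ (r + 2)) z :=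
      hzmin.isLocalMin (Filter.mem_of_superset (isOpen_ball.mem_nhds hzball) ball_subset_closedBall)
    have hzc : z = c := by
      by_contra hne
      have hle := IsLocalMin.neg_mul_le_sum_of_add_norm_rpow hr hrs hk hne hloc
        (by filter_upwards [isOpen_ball.mem_nhds (hsub hz)] with v hv using hw v hv)
        (hW z (hsub hz)).hasFDerivAt
      exact absurd (hdiv z (hsub hz)) (not_lt.2 hle)
    subst hzc
    have hgrad := (hw z (hsub hz)).add
      ((HasFDerivAt.comp (f := fun v => v - z) z
        (hasFDerivAt_norm_rpow (z - z) (show 1 < r + 2 by linarith))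
        ((hasFDerivAt_id z).sub_const z)).const_mul C)
    have h0 := hloc.hasFDerivAt_eq_zero hgrad
    have hWz : ‖W z‖ ^ r • W z = 0 := by
      rw [← inner_self_eq_zero (𝕜 := ℝ)]
      simpa using DFunLike.congr_fun h0 (‖W z‖ ^ r • W z)
    rw [← norm_rpow_smul_norm_rpow_smul hrs (W z), hWz, smul_zero]
  have hfd : fderiv ℝ W x = 0 := by
    have : W =ᶠ[𝓝 x] fun _ => 0 := hzero
    rw [this.fderiv_eq]
    simp
  have hneg := hdiv x hxR
  simp only [pdiv, hfd, zero_apply, PiLp.zero_apply, Finset.sum_const_zero] at hneg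
  have : 0 ≤ k * N := by positivity
  linarith

lemma pdiv_smul {N : ℕ} {φ : EuclideanSpace ℝ (Fin N) → ℝ}
    {V : EuclideanSpace ℝ (Fin N) → EuclideanSpace ℝ (Fin N)} {x g : EuclideanSpace ℝ (Fin N)}
    (hφ : HasFDerivAt φ (innerSL ℝ g) x) (hV : DifferentiableAt ℝ V x) :
    pdiv (fun y => φ y • V y) x = φ x * pdiv V x + inner ℝ g (V x) := by
  have h : HasFDerivAt (fun y => φ y • V y)
      (φ x • fderiv ℝ V x + (innerSL ℝ g).smulRight (V x)) x := hφ.smul hV.hasFDerivAt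
  rw [pdiv, h.fderiv, pdiv, Finset.mul_sum]
  simp [Finset.sum_add_distrib, PiLp.inner_apply, mul_comm]

lemma hasFDerivAt_innerSL_gradient {E : Type*} [NormedAddCommGroup E] [InnerProductSpace ℝ E]
    [CompleteSpace E] {u : E → ℝ} {x : E} (hu : DifferentiableAt ℝ u x) :
    HasFDerivAt u (innerSL ℝ (gradient u x)) x :=
  hu.hasGradientAt.hasFDerivAt

/-- Theorem 2.2, inequality (2.3): pointwise lower bound
`F(u(y)) ≥ ((p-1)/p) ρ_x(d_Ω(x))^(1/(p-1)) (d_Ω(x)^(p/(p-1)) - ‖x-y‖^(p/(p-1)))/N^(1/(p-1))`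
for any `C¹` positive supersolution `u` of `-Δ_p u = ρ(x) f(u)` vanishing on `∂Ω`,
where `d_Ω(x) = dist(x, Ωᶜ)` and `ρ_x(r) = inf {ρ(y) : ‖y - x‖ < r}`. -/
theorem stmt8 {N : ℕ} (hN : 1 ≤ N) (p : ℝ) (hp : 1 < p)
    (Ω : Set (EuclideanSpace ℝ (Fin N))) (hΩo : IsOpen Ω) (hΩb : Bornology.IsBounded Ω)
    (ρ : EuclideanSpace ℝ (Fin N) → ℝ)
    (hρ0 : ∀ x ∈ Ω, 0 ≤ ρ x) (hρb : BddAbove (ρ '' Ω))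
    (af : EReal) (haf : 0 < af) (f : ℝ → ℝ)
    (hf0 : ∀ t : ℝ, 0 ≤ t → (t : EReal) < af → 0 ≤ f t)
    (hfpos : ∀ t : ℝ, 0 < t → (t : EReal) < af → 0 < f t)
    (hmono : MonotoneOn f {t : ℝ | 0 ≤ t ∧ (t : EReal) < af})
    (hreg : ContDiffOn ℝ 1 f {t : ℝ | 0 ≤ t ∧ (t : EReal) < af})
    (hint : ∀ a : ℝ, 0 < a → (a : EReal) < af →
      IntegrableOn (fun s => f s ^ (-(1 / (p - 1)))) (Ioo 0 a))
    (F : ℝ → ℝ) (hF : F = fun t => ∫ s in (0:ℝ)..t, f s ^ (-(1 / (p - 1))))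
    (u : EuclideanSpace ℝ (Fin N) → ℝ)
    (huc : ContinuousOn u (closure Ω)) (hu1 : ContDiffOn ℝ 1 u Ω)
    (hurange : ∀ x ∈ Ω, 0 < u x ∧ ((u x : ℝ) : EReal) < af)
    (hubd : ∀ x ∈ frontier Ω, u x = 0)
    (hflux : ContDiffOn ℝ 1 (flux p u) Ω)
    (hsuper : ∀ x ∈ Ω, pdiv (flux p u) x ≤ -(ρ x * f (u x))) :
    ∀ x ∈ Ω, ∀ y : EuclideanSpace ℝ (Fin N), ‖y - x‖ < infDist x Ωᶜ →
      ((p - 1) / p) * sInf (ρ '' ball x (infDist x Ωᶜ)) ^ (1 / (p - 1)) *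
        ((infDist x Ωᶜ ^ (p / (p - 1)) - ‖x - y‖ ^ (p / (p - 1))) / (N : ℝ) ^ (1 / (p - 1)))
        ≤ F (u y) := by

  intro x hx y hy
  set R := infDist x Ωᶜ with hR
  have hball : ball x R ⊆ Ω := ball_infDist_compl_subset
  have hRpos : 0 < R := (norm_nonneg _).trans_lt hy
  have hp1 : 0 < p - 1 := by linarith
  have hyR : y ∈ ball x R := by rwa [mem_ball, dist_eq_norm]
  have hfu : ∀ z ∈ Ω, 0 < f (u z) := fun z hz => hfpos _ (hurange z hz).1 (hurange z hz).2
  have hcoe : ∀ s t : ℝ, s ≤ t → (t : EReal) < af → (s : EReal) < af := fun s t hst ht =>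
    (EReal.coe_le_coe_iff.2 hst).trans_lt ht
  have hFnonneg : ∀ z ∈ Ω, 0 ≤ F (u z) := by
    intro z hz
    obtain ⟨h0, h1⟩ := hurange z hz
    rw [hF]
    exact intervalIntegral.integral_nonneg h0.le fun t ht =>
      Real.rpow_nonneg (hf0 t ht.1 (hcoe t _ ht.2 h1)) _
  have hopen : IsOpen {t : ℝ | 0 < t ∧ (t : EReal) < af} :=
    isOpen_Ioi.inter (isOpen_Iio.preimage continuous_coe_real_ereal)
  have hfdiff : ∀ t : ℝ, 0 < t → (t : EReal) < af → DifferentiableAt ℝ f t := fun t h0 h1 =>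
    (hreg.differentiableOn one_ne_zero).differentiableAt
      (Filter.mem_of_superset (hopen.mem_nhds ⟨h0, h1⟩) fun s hs => ⟨hs.1.le, hs.2⟩)
  have hfderiv : ∀ t : ℝ, 0 < t → (t : EReal) < af → 0 ≤ deriv f t := fun t h0 h1 => by
    rw [← derivWithin_of_isOpen hopen ⟨h0, h1⟩]
    exact (hmono.mono fun s hs => ⟨hs.1.le, hs.2⟩).derivWithin_nonneg
  have hFderiv : ∀ t : ℝ, 0 < t → (t : EReal) < af →
      HasDerivAt F (f t ^ (-(1 / (p - 1)))) t := by
    intro t h0 h1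
    have hcts : ContinuousOn (fun s => f s ^ (-(1 / (p - 1))))
        {t : ℝ | 0 < t ∧ (t : EReal) < af} := fun s hs =>
      ((hfdiff s hs.1 hs.2).continuousAt.rpow_const
        (Or.inl (hfpos s hs.1 hs.2).ne')).continuousWithinAt
    rw [hF]
    refine intervalIntegral.integral_hasDerivAt_right ?_
      (hcts.stronglyMeasurableAtFilter hopen t ⟨h0, h1⟩)
      (hcts.continuousAt (hopen.mem_nhds ⟨h0, h1⟩))
    rw [intervalIntegrable_iff_integrableOn_Ioo_of_le h0.le]
    exact hint t h0 h1
  have hudiff : ∀ z ∈ Ω, DifferentiableAt ℝ u z := fun z hz =>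
    (hu1.differentiableOn one_ne_zero).differentiableAt (hΩo.mem_nhds hz)
  have hVdiff : ∀ z ∈ Ω, DifferentiableAt ℝ (flux p u) z := fun z hz =>
    (hflux.differentiableOn one_ne_zero).differentiableAt (hΩo.mem_nhds hz)
  set W : EuclideanSpace ℝ (Fin N) → EuclideanSpace ℝ (Fin N) :=
    fun z => (f (u z))⁻¹ • flux p u z with hWdef
  set r : ℝ := 1 / (p - 1) - 1 with hr
  have hr1 : -1 < r := by
    have : 0 < 1 / (p - 1) := by positivity
    linarith
  have hrs : (1 + r) * (1 + (p - 2)) = 1 := by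
    rw [hr]
    field_simp
    ring
  have hinv : ∀ z ∈ Ω, HasFDerivAt (fun v => (f (u v))⁻¹)
      (innerSL ℝ ((-deriv f (u z) / f (u z) ^ 2) • gradient u z)) z := by
    intro z hz
    obtain ⟨h0, h1⟩ := hurange z hz
    have := ((hfdiff _ h0 h1).hasDerivAt.inv (hfu z hz).ne').comp_hasFDerivAt z
      (hasFDerivAt_innerSL_gradient (hudiff z hz))
    refine this.congr_fderiv ?_
    rw [map_smul]
  have hWdiff : ∀ z ∈ Ω, DifferentiableAt ℝ W z := fun z hz =>
    (hinv z hz).differentiableAt.smul (hVdiff z hz)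
  have hWdiv : ∀ z ∈ Ω, pdiv W z ≤ -ρ z := by
    intro z hz
    obtain ⟨h0, h1⟩ := hurange z hz
    have hf := hfu z hz
    rw [hWdef, pdiv_smul (hinv z hz) (hVdiff z hz), flux, real_inner_smul_left,
      real_inner_smul_right]
    have h2 : (f (u z))⁻¹ * pdiv (flux p u) z ≤ (f (u z))⁻¹ * -(ρ z * f (u z)) :=
      mul_le_mul_of_nonneg_left (hsuper z hz) (by positivity)
    have h3 : (f (u z))⁻¹ * -(ρ z * f (u z)) = -ρ z := by field_simp
    have h4 : 0 ≤ deriv f (u z) / f (u z) ^ 2 *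
        (‖gradient u z‖ ^ (p - 2) * inner ℝ (gradient u z) (gradient u z)) :=
      mul_nonneg (div_nonneg (hfderiv _ h0 h1) (by positivity))
        (mul_nonneg (by positivity) real_inner_self_nonneg)
    rw [neg_div, neg_mul]
    linarith
  have hgradF : ∀ z ∈ Ω, HasFDerivAt (fun v => F (u v)) (innerSL ℝ (‖W z‖ ^ r • W z)) z := by
    intro z hz
    obtain ⟨h0, h1⟩ := hurange z hz
    have hf := hfu z hz
    have hWz : W z = ‖f (u z) ^ (-(1 / (p - 1))) • gradient u z‖ ^ (p - 2) •
        (f (u z) ^ (-(1 / (p - 1))) • gradient u z) := by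
      have hpow : 0 < f (u z) ^ (-(1 / (p - 1))) := by positivity
      rw [hWdef, norm_smul, Real.norm_of_nonneg hpow.le,
        Real.mul_rpow hpow.le (norm_nonneg _), smul_smul, ← Real.rpow_mul hf.le]
      simp only [flux, smul_smul]
      rw [mul_right_comm, ← Real.rpow_add hf, ← Real.rpow_neg_one]
      congr 3
      field_simp
      ring
    have := (hFderiv _ h0 h1).comp_hasFDerivAt z (hasFDerivAt_innerSL_gradient (hudiff z hz))
    refine this.congr_fderiv ?_
    rw [hWz, norm_rpow_smul_norm_rpow_smul (by linarith), map_smul]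
  set ρ₀ := sInf (ρ '' ball x R) with hρ₀
  have hbdd : BddBelow (ρ '' ball x R) := ⟨0, by
    rintro _ ⟨z, hz, rfl⟩
    exact hρ0 z (hball hz)⟩
  have hρ₀le : ∀ z ∈ ball x R, ρ₀ ≤ ρ z := fun z hz => csInf_le hbdd ⟨z, hz, rfl⟩
  have hρ₀0 : 0 ≤ ρ₀ := Real.sInf_nonneg (by
    rintro _ ⟨z, hz, rfl⟩
    exact hρ0 z (hball hz))
  have hNpos : (0 : ℝ) < N := by exact_mod_cast hN
  have hr1' : r + 1 = 1 / (p - 1) := by rw [hr]; ring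
  have hr2' : r + 2 = p / (p - 1) := by rw [hr]; field_simp; ring
  rcases hρ₀0.eq_or_lt with hzero | hpos
  · rw [← hzero, Real.zero_rpow (by positivity)]
    simpa using hFnonneg y (hball hyR)
  have hmain : ∀ k ∈ Ioo 0 (ρ₀ / N),
      k ^ (r + 1) / (r + 2) * (R ^ (r + 2) - ‖x - y‖ ^ (r + 2)) ≤ F (u y) := by
    rintro k ⟨hk0, hk1⟩
    rw [lt_div_iff₀ hNpos] at hk1
    exact le_of_pdiv_lt (w := fun v => F (u v)) hr1 hrs hk0 (fun z hz => hFnonneg z (hball hz))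
      (fun z hz => hgradF z (hball hz)) (fun z hz => hWdiff z (hball hz))
      (fun z hz => by linarith [hWdiv z (hball hz), hρ₀le z hz]) hyR
  have hlim : Tendsto (fun k : ℝ => k ^ (r + 1) / (r + 2) * (R ^ (r + 2) - ‖x - y‖ ^ (r + 2)))
      (𝓝[<] (ρ₀ / N))
      (𝓝 ((ρ₀ / N) ^ (r + 1) / (r + 2) * (R ^ (r + 2) - ‖x - y‖ ^ (r + 2)))) :=
    (((Real.continuous_rpow_const (by linarith)).div_const _).mul_const
      _).continuousAt.tendsto.mono_left nhdsWithin_le_nhds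
  have hle := le_of_tendsto hlim (by
    filter_upwards [Ioo_mem_nhdsLT (show 0 < ρ₀ / N by positivity)] with k hk using hmain k hk)
  rw [Real.div_rpow hρ₀0 hNpos.le, hr1', hr2'] at hle
  refine le_of_eq_of_le ?_ hle
  field_simp
end

section
/- Let p > 1 and let Ω ⊂ ℝ^N be a bounded open set. Let ρ : Ω → [0, ∞) be bounded, let f satisfy condition (C) with s ↦ f(s)^{−1/(p−1)} integrable on (0, a) for every a ∈ (0, a_f), and let F(t) = ∫₀ᵗ f(s)^{−1/(p−1)} ds. Suppose u : cl(Ω) → ℝ is continuous, is C¹ on Ω with 0 < u(x) < a_f for x ∈ Ω and u = 0 on ∂Ω, its flux V_u is continuously differentiable on Ω, and div V_u(x) ≤ −ρ(x)f(u(x)) for all x ∈ Ω. Then for every x ∈ Ω one has F(u(x)) ≥ ((p−1)/p)·(ρ_x(d_Ω(x))·d_Ω(x)^p/N)^{1/(p−1)}. -/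
open Real Set Metric MeasureTheory

theorem inner_norm_rpow_smul_sub_nonneg {E : Type*} [NormedAddCommGroup E] [InnerProductSpace ℝ E]
    {p : ℝ} (hp : 1 < p) (a b : E) :
    0 ≤ inner ℝ (‖a‖ ^ (p - 2) • a - ‖b‖ ^ (p - 2) • b) (a - b) := by
  have hpow : ∀ s : ℝ, 0 ≤ s → s ^ (p - 2) * s = s ^ (p - 1) := fun s hs => by
    rw [← Real.rpow_add_one' hs (by linarith)]
    ring_nf
  have key : 0 ≤ (‖a‖ ^ (p - 1) - ‖b‖ ^ (p - 1)) * (‖a‖ - ‖b‖) := by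
    rcases le_total ‖a‖ ‖b‖ with h | h
    · exact mul_nonneg_of_nonpos_of_nonpos
        (sub_nonpos.2 (Real.rpow_le_rpow (norm_nonneg _) h (by linarith))) (sub_nonpos.2 h)
    · exact mul_nonneg
        (sub_nonneg.2 (Real.rpow_le_rpow (norm_nonneg _) h (by linarith))) (sub_nonneg.2 h)
  rw [← hpow _ (norm_nonneg a), ← hpow _ (norm_nonneg b)] at key
  have hcs : (‖a‖ ^ (p - 2) + ‖b‖ ^ (p - 2)) * inner ℝ a b
      ≤ (‖a‖ ^ (p - 2) + ‖b‖ ^ (p - 2)) * (‖a‖ * ‖b‖) :=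
    mul_le_mul_of_nonneg_left (real_inner_le_norm a b) (by positivity)
  simp only [inner_sub_left, inner_sub_right, real_inner_smul_left,
    real_inner_self_eq_norm_sq, real_inner_comm a b]
  nlinarith

section Divergence

variable {N : ℕ}

theorem sum_apply_single (L : EuclideanSpace ℝ (Fin N) →L[ℝ] ℝ) (v : EuclideanSpace ℝ (Fin N)) :
    ∑ i, L (EuclideanSpace.single i 1) * v i = L v := by
  conv_rhs => rw [← (EuclideanSpace.basisFun (Fin N) ℝ).sum_repr v]
  simp [map_sum, mul_comm]

theorem pdiv_smul_s9 {h : EuclideanSpace ℝ (Fin N) → ℝ}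
    {W : EuclideanSpace ℝ (Fin N) → EuclideanSpace ℝ (Fin N)} {x : EuclideanSpace ℝ (Fin N)}
    (hh : DifferentiableAt ℝ h x) (hW : DifferentiableAt ℝ W x) :
    pdiv (fun y => h y • W y) x = h x * pdiv W x + fderiv ℝ h x (W x) := by
  simp [pdiv, fderiv_fun_smul hh hW, Finset.sum_add_distrib, Finset.mul_sum, sum_apply_single]

theorem pdiv_add {V W : EuclideanSpace ℝ (Fin N) → EuclideanSpace ℝ (Fin N)}
    {x : EuclideanSpace ℝ (Fin N)} (hV : DifferentiableAt ℝ V x) (hW : DifferentiableAt ℝ W x) :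
    pdiv (fun y => V y + W y) x = pdiv V x + pdiv W x := by
  simp [pdiv, fderiv_fun_add hV hW, Finset.sum_add_distrib]

theorem pdiv_smul_sub_const (k : ℝ) (x₀ x : EuclideanSpace ℝ (Fin N)) :
    pdiv (fun y => k • (y - x₀)) x = k * N := by
  have : fderiv ℝ (fun y : EuclideanSpace ℝ (Fin N) => k • (y - x₀)) x
      = k • ContinuousLinearMap.id ℝ _ :=
    (((hasFDerivAt_id x).sub_const x₀).const_smul k).fderiv
  simp [pdiv, this, mul_comm]

theorem continuous_pdiv {X : EuclideanSpace ℝ (Fin N) → EuclideanSpace ℝ (Fin N)}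
    (hX : ContDiff ℝ 1 X) : Continuous (pdiv X) := by
  have := hX.continuous_fderiv one_ne_zero
  unfold pdiv
  fun_prop

theorem hasCompactSupport_pdiv {X : EuclideanSpace ℝ (Fin N) → EuclideanSpace ℝ (Fin N)}
    (hX : HasCompactSupport X) : HasCompactSupport (pdiv X) :=
  (hX.fderiv (𝕜 := ℝ)).comp_left
    (g := fun L : EuclideanSpace ℝ (Fin N) →L[ℝ] EuclideanSpace ℝ (Fin N) =>
      ∑ i, L (EuclideanSpace.single i 1) i) (by simp)

/-- The **divergence theorem** for compactly supported fields. -/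
theorem integral_pdiv_eq_zero {X : EuclideanSpace ℝ (Fin N) → EuclideanSpace ℝ (Fin N)}
    (hX : ContDiff ℝ 1 X) (hc : HasCompactSupport X) : ∫ x, pdiv X x = 0 := by
  have hcont := hX.continuous_fderiv one_ne_zero
  have hint : ∀ v : EuclideanSpace ℝ (Fin N), Integrable (fun x => fderiv ℝ X x v) := fun v =>
    (by fun_prop : Continuous fun x => fderiv ℝ X x v).integrable_of_hasCompactSupport
      ((hc.fderiv (𝕜 := ℝ)).comp_left
        (g := fun L : EuclideanSpace ℝ (Fin N) →L[ℝ] EuclideanSpace ℝ (Fin N) => L v) (by simp))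
  have hzero : ∀ v : EuclideanSpace ℝ (Fin N), ∫ x, fderiv ℝ X x v = 0 := fun v => by
    have := integral_smul_fderiv_eq_neg_fderiv_smul_of_integrable (μ := volume)
      (f := fun _ : EuclideanSpace ℝ (Fin N) => (1 : ℝ)) (g := X) (v := v)
      (by simp) (by simpa using hint v)
      (by simpa using hX.continuous.integrable_of_hasCompactSupport hc)
      (fun _ _ => differentiableAt_const _) (fun x _ => hX.differentiable one_ne_zero x)
    simpa using this
  have hproj : ∀ (v : EuclideanSpace ℝ (Fin N)) (i : Fin N),
      ∫ x, fderiv ℝ X x v i = 0 := fun v i => by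
    have := (EuclideanSpace.proj (𝕜 := ℝ) i).integral_comp_comm (hint v)
    simpa [hzero v] using this
  have hcoord : ∀ (v : EuclideanSpace ℝ (Fin N)) (i : Fin N),
      Integrable fun x => fderiv ℝ X x v i := fun v i =>
    (EuclideanSpace.proj (𝕜 := ℝ) i).integrable_comp (hint v)
  unfold pdiv
  rw [integral_finsetSum _ fun i _ => hcoord _ i]
  simp [hproj]

/-- A comparison principle: a function that does not decrease along a field `W`, and that is
nonnegative off a compact set, is nonnegative if `W` has negative divergence where it is not. -/
theorem nonneg_of_pdiv_neg {Ω K : Set (EuclideanSpace ℝ (Fin N))} (hΩ : IsOpen Ω)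
    (hK : IsCompact K) (hKΩ : K ⊆ Ω) {g : EuclideanSpace ℝ (Fin N) → ℝ}
    {W : EuclideanSpace ℝ (Fin N) → EuclideanSpace ℝ (Fin N)}
    (hg : ContDiffOn ℝ 1 g Ω) (hW : ContDiffOn ℝ 1 W Ω)
    (hgW : ∀ x ∈ Ω, 0 ≤ fderiv ℝ g x (W x)) (hdiv : ∀ x ∈ Ω, g x < 0 → pdiv W x < 0)
    (hoff : ∀ x ∈ Ω, x ∉ K → 0 ≤ g x) : ∀ x ∈ Ω, 0 ≤ g x := by
  classical
  set h : EuclideanSpace ℝ (Fin N) → ℝ := fun x => expNegInvGlue (-g x) with hh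
  set X : EuclideanSpace ℝ (Fin N) → EuclideanSpace ℝ (Fin N) :=
    fun x => if x ∈ Ω then h x • W x else 0 with hXdef
  have hglue : ContDiff ℝ 1 expNegInvGlue := expNegInvGlue.contDiff (n := 1)
  have hXoff : ∀ x ∉ K, X x = 0 := fun x hx => by
    by_cases hxΩ : x ∈ Ω
    · simp [hXdef, hh, hxΩ, hoff x hxΩ hx]
    · simp [hXdef, hxΩ]
  have hXon : ∀ x ∈ Ω, X =ᶠ[nhds x] fun y => h y • W y := fun x hx => by
    filter_upwards [hΩ.mem_nhds hx] with y hy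
    simp [hXdef, hy]
  have hgd : ∀ x ∈ Ω, ContDiffAt ℝ 1 g x := fun x hx => hg.contDiffAt (hΩ.mem_nhds hx)
  have hWd : ∀ x ∈ Ω, ContDiffAt ℝ 1 W x := fun x hx => hW.contDiffAt (hΩ.mem_nhds hx)
  have hhd : ∀ x ∈ Ω, ContDiffAt ℝ 1 h x := fun x hx =>
    hglue.contDiffAt.comp x (hgd x hx).neg
  have hXc : HasCompactSupport X := HasCompactSupport.intro hK hXoff
  have hX1 : ContDiff ℝ 1 X := contDiff_iff_contDiffAt.2 fun x => by
    by_cases hx : x ∈ K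
    · exact ((hhd x (hKΩ hx)).smul (hWd x (hKΩ hx))).congr_of_eventuallyEq (hXon x (hKΩ hx))
    · refine (contDiffAt_const (c := (0 : EuclideanSpace ℝ (Fin N)))).congr_of_eventuallyEq ?_
      filter_upwards [hK.isClosed.isOpen_compl.mem_nhds hx] with y hy using hXoff y hy
  have hhfd : ∀ x ∈ Ω, fderiv ℝ h x (W x) ≤ 0 := fun x hx => by
    have h1 : HasFDerivAt h (deriv expNegInvGlue (-g x) • -fderiv ℝ g x) x :=
      (hglue.differentiable one_ne_zero _).hasDerivAt.comp_hasFDerivAt x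
        ((hgd x hx).differentiableAt one_ne_zero).hasFDerivAt.neg
    have h2 : 0 ≤ deriv expNegInvGlue (-g x) := expNegInvGlue.monotone.deriv_nonneg
    rw [h1.fderiv]
    simpa using mul_nonneg h2 (hgW x hx)
  have hpX : ∀ x ∈ Ω, pdiv X x = h x * pdiv W x + fderiv ℝ h x (W x) := fun x hx => by
    rw [← pdiv_smul_s9 ((hhd x hx).differentiableAt one_ne_zero)
      ((hWd x hx).differentiableAt one_ne_zero)]
    simp [pdiv, (hXon x hx).fderiv_eq]
  have hneg : ∀ x, pdiv X x ≤ 0 := fun x => by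
    by_cases hx : x ∈ Ω
    · rw [hpX x hx]
      rcases le_or_gt 0 (g x) with h0 | h0
      · simpa [hh, expNegInvGlue.zero_of_nonpos (neg_nonpos.2 h0)] using hhfd x hx
      · exact add_nonpos (mul_nonpos_of_nonneg_of_nonpos (expNegInvGlue.nonneg _)
          (hdiv x hx h0).le) (hhfd x hx)
    · have : X =ᶠ[nhds x] fun _ => 0 := by
        filter_upwards [hK.isClosed.isOpen_compl.mem_nhds fun hxK => hx (hKΩ hxK)] with y hy
          using hXoff y hy
      simp [pdiv, this.fderiv_eq]
  intro x hx
  by_contra! hgx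
  have hlt : pdiv X x < 0 := by
    rw [hpX x hx]
    exact add_neg_of_neg_of_nonpos
      (mul_neg_of_pos_of_neg (expNegInvGlue.pos_of_pos (neg_pos.2 hgx)) (hdiv x hx hgx))
      (hhfd x hx)
  have hpos := (continuous_pdiv hX1).neg.integral_pos_of_hasCompactSupport_nonneg_nonzero
    (μ := volume) (hasCompactSupport_pdiv hXc).neg (fun y => neg_nonneg.2 (hneg y))
    (x := x) (by simpa using hlt.ne)
  simp [integral_neg, integral_pdiv_eq_zero hX1 hXc] at hpos

end Divergence

section Flux

variable {E : Type*} [NormedAddCommGroup E] [InnerProductSpace ℝ E] {p : ℝ}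

theorem norm_rpow_smul_smul (hp : 1 < p) {c : ℝ} (hc : 0 ≤ c) (z : E) :
    ‖c • z‖ ^ (p - 2) • (c • z) = c ^ (p - 1) • (‖z‖ ^ (p - 2) • z) := by
  have : c ^ (p - 1) = c ^ (p - 2) * c := by
    rw [← Real.rpow_add_one' hc (by linarith)]
    ring_nf
  rw [norm_smul, Real.norm_of_nonneg hc, Real.mul_rpow hc (norm_nonneg z), this, smul_smul,
    smul_smul]
  ring_nf

theorem norm_rpow_smul_conjugate (hp : 1 < p) (y : E) :
    ‖‖y‖ ^ (p / (p - 1) - 2) • y‖ ^ (p - 2) • (‖y‖ ^ (p / (p - 1) - 2) • y) = y := by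
  rcases eq_or_ne y 0 with rfl | hy
  · simp
  have hy' : 0 < ‖y‖ := norm_pos_iff.2 hy
  have hp' : p - 1 ≠ 0 := by linarith
  rw [norm_rpow_smul_smul hp (by positivity), smul_smul, ← Real.rpow_mul hy'.le,
    ← Real.rpow_add hy']
  have : (p / (p - 1) - 2) * (p - 1) + (p - 2) = 0 := by
    field_simp
    ring
  simp [this]

end Flux

section Comparison

variable {N : ℕ} {p : ℝ} {I : Set ℝ} {f F : ℝ → ℝ} {Ω : Set (EuclideanSpace ℝ (Fin N))}
  {u : EuclideanSpace ℝ (Fin N) → ℝ}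

theorem fderiv_apply_eq_inner_gradient {x : EuclideanSpace ℝ (Fin N)}
    (v : EuclideanSpace ℝ (Fin N)) : fderiv ℝ u x v = inner ℝ (gradient u x) v := by
  rw [← toDual_gradient, InnerProductSpace.toDual_apply_apply]

/-- The field `V_u / f(u) + k (· - x₀)`, the difference of the fluxes of `F ∘ u` and of the radial
solution of `-Δ_p φ = k N`, has negative divergence where `-Δ_p u > k N f(u)`. -/
theorem pdiv_inv_smul_flux_add_neg (hI : IsOpen I) (hΩ : IsOpen Ω)
    (hf : ContDiffOn ℝ 1 f I) (hfpos : ∀ t ∈ I, 0 < f t) (hmono : MonotoneOn f I)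
    (hu : ContDiffOn ℝ 1 u Ω) (huI : ∀ x ∈ Ω, u x ∈ I) (hflux : ContDiffOn ℝ 1 (flux p u) Ω)
    (x₀ : EuclideanSpace ℝ (Fin N)) {c k : ℝ} (hck : k * N < c)
    {x : EuclideanSpace ℝ (Fin N)} (hx : x ∈ Ω) (hsuper : pdiv (flux p u) x ≤ -(c * f (u x))) :
    pdiv (fun y => (f (u y))⁻¹ • flux p u y + k • (y - x₀)) x < 0 := by
  have hfx := hfpos _ (huI x hx)
  have hud := ((hu.contDiffAt (hΩ.mem_nhds hx)).differentiableAt one_ne_zero).hasFDerivAt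
  have hfd := ((hf.contDiffAt (hI.mem_nhds (huI x hx))).differentiableAt one_ne_zero).hasDerivAt
  have hVd := (hflux.contDiffAt (hΩ.mem_nhds hx)).differentiableAt one_ne_zero
  have hf' : 0 ≤ deriv f (u x) := by
    rw [← derivWithin_of_mem_nhds (hI.mem_nhds (huI x hx))]
    exact hmono.derivWithin_nonneg
  have hinv : HasFDerivAt (fun y => (f (u y))⁻¹)
      ((-deriv f (u x) / f (u x) ^ 2) • fderiv ℝ u x) x :=
    (hfd.inv hfx.ne').comp_hasFDerivAt x hud
  rw [pdiv_add (hinv.differentiableAt.fun_smul hVd) (by fun_prop),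
    pdiv_smul_s9 hinv.differentiableAt hVd, pdiv_smul_sub_const, hinv.fderiv]
  have h1 : (f (u x))⁻¹ * pdiv (flux p u) x ≤ -c := by
    rw [inv_mul_le_iff₀ hfx]
    linarith
  have h2 : ((-deriv f (u x) / f (u x) ^ 2) • fderiv ℝ u x) (flux p u x) ≤ 0 := by
    rw [smul_apply, fderiv_apply_eq_inner_gradient, flux, inner_smul_right,
      real_inner_self_eq_norm_sq, smul_eq_mul, neg_div, neg_mul]
    exact neg_nonpos.2 (by positivity)
  linarith

theorem radial_le_comp_of_pdiv_flux_le (hN : 1 ≤ N) (hp : 1 < p) (hI : IsOpen I) (hΩ : IsOpen Ω)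
    (hf : ContDiffOn ℝ 1 f I) (hfpos : ∀ t ∈ I, 0 < f t) (hmono : MonotoneOn f I)
    (hF : ∀ t ∈ I, HasDerivAt F (f t ^ (-(1 / (p - 1)))) t) (hF0 : ∀ t ∈ I, 0 ≤ F t)
    (hu : ContDiffOn ℝ 1 u Ω) (huI : ∀ x ∈ Ω, u x ∈ I) (hflux : ContDiffOn ℝ 1 (flux p u) Ω)
    {x₀ : EuclideanSpace ℝ (Fin N)} {R c c' : ℝ} (hR : 0 ≤ R) (hball : closedBall x₀ R ⊆ Ω)
    (hc' : 0 ≤ c') (hcc : c' < c)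
    (hsuper : ∀ x ∈ closedBall x₀ R, pdiv (flux p u) x ≤ -(c * f (u x))) :
    (p - 1) / p * (c' * R ^ p / N) ^ (1 / (p - 1)) ≤ F (u x₀) := by
  have hp1 : 0 < p - 1 := by linarith
  have hp0 : 0 < p := by linarith
  have hN0 : (0 : ℝ) < N := by exact_mod_cast hN
  set k : ℝ := c' / N with hk
  have hk0 : 0 ≤ k := by positivity
  set q : ℝ := p / (p - 1) with hq
  have hq1 : 1 < q := by
    rw [hq, one_lt_div hp1]
    linarith
  set A : ℝ := (p - 1) / p * k ^ (1 / (p - 1)) with hA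
  have hA0 : 0 ≤ A := by positivity
  have hFC : ContDiffOn ℝ 1 F I := by
    refine (contDiffOn_succ_iff_deriv_of_isOpen (n := 0) hI).2
      ⟨fun t ht => (hF t ht).differentiableAt.differentiableWithinAt, by simp, ?_⟩
    rw [contDiffOn_zero]
    exact (hf.continuousOn.rpow_const fun t ht => Or.inl (hfpos t ht).ne').congr
      fun t ht => (hF t ht).deriv
  have hgC : ContDiffOn ℝ 1 (fun y => F (u y) - A * (R ^ q - ‖y - x₀‖ ^ q)) Ω := by
    have hn : ContDiff ℝ 1 fun y : EuclideanSpace ℝ (Fin N) => ‖y - x₀‖ ^ q :=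
      (contDiff_id.sub contDiff_const).norm_rpow hq1
    exact (hFC.comp hu huI).sub (contDiff_const.mul (contDiff_const.sub hn)).contDiffOn
  have hWC : ContDiffOn ℝ 1 (fun y => (f (u y))⁻¹ • flux p u y + k • (y - x₀)) Ω :=
    (((hf.comp hu huI).inv fun x hx => (hfpos _ (huI x hx)).ne').smul hflux).add
      ((contDiff_id.sub contDiff_const).const_smul k).contDiffOn
  have hoff : ∀ x ∈ Ω, x ∉ closedBall x₀ R →
      0 ≤ F (u x) - A * (R ^ q - ‖x - x₀‖ ^ q) := fun x hx hxR => by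
    rw [mem_closedBall, dist_eq_norm, not_le] at hxR
    have := Real.rpow_le_rpow hR hxR.le (by linarith : 0 ≤ q)
    nlinarith [hF0 _ (huI x hx), mul_nonneg hA0 (sub_nonneg.2 this)]
  have hmain := nonneg_of_pdiv_neg hΩ (isCompact_closedBall x₀ R) hball hgC hWC ?_ ?_ hoff x₀
    (hball (mem_closedBall_self hR))
  · have hR' : (R ^ p) ^ (1 / (p - 1)) = R ^ q := by
      rw [← Real.rpow_mul hR, hq, mul_one_div]
    rw [mul_div_right_comm, Real.mul_rpow hk0 (by positivity), hR', ← mul_assoc, ← hA]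
    simpa [Real.zero_rpow (by linarith : q ≠ 0)] using hmain
  · intro x hx
    have hfx := hfpos _ (huI x hx)
    have hd : HasFDerivAt (fun y => F (u y) - A * (R ^ q - ‖y - x₀‖ ^ q))
        (f (u x) ^ (-(1 / (p - 1))) • fderiv ℝ u x
          - A • -((q * ‖x - x₀‖ ^ (q - 2)) • innerSL ℝ (x - x₀))) x := by
      have hud := ((hu.contDiffAt (hΩ.mem_nhds hx)).differentiableAt one_ne_zero).hasFDerivAt
      have hn := (hasFDerivAt_norm_rpow (x - x₀) hq1).comp x ((hasFDerivAt_id x).sub_const x₀)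
      exact ((hF _ (huI x hx)).comp_hasFDerivAt x hud).sub ((hn.const_sub (R ^ q)).const_mul A)
    have hmonoV := inner_norm_rpow_smul_sub_nonneg hp
      (f (u x) ^ (-(1 / (p - 1))) • gradient u x)
      (-(k ^ (1 / (p - 1)) • (‖x - x₀‖ ^ (q - 2) • (x - x₀))))
    have hAq : A * q = k ^ (1 / (p - 1)) := by
      rw [hA, hq]
      field_simp
    have e1 : (f (u x) ^ (-(1 / (p - 1)))) ^ (p - 1) = (f (u x))⁻¹ := by
      rw [← Real.rpow_mul hfx.le, ← Real.rpow_neg_one]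
      congr 1
      field_simp
    have e2 : (k ^ (1 / (p - 1))) ^ (p - 1) = k := by
      rw [← Real.rpow_mul hk0, one_div_mul_cancel hp1.ne', Real.rpow_one]
    rw [norm_neg, smul_neg, norm_rpow_smul_smul hp (by positivity),
      norm_rpow_smul_smul hp (by positivity), hq, norm_rpow_smul_conjugate hp, ← hq, e1, e2,
      sub_neg_eq_add, sub_neg_eq_add, real_inner_comm] at hmonoV
    rw [hd.fderiv]
    convert hmonoV using 1
    rw [inner_add_left, real_inner_smul_left, real_inner_smul_left, real_inner_smul_left, ← hAq]
    simp only [sub_apply, smul_apply,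
      neg_apply, innerSL_apply_apply, smul_eq_mul,
      fderiv_apply_eq_inner_gradient, flux]
    ring
  · intro x hx hgx
    have hxR : x ∈ closedBall x₀ R := by
      by_contra h
      exact absurd hgx (hoff x hx h).not_gt
    refine pdiv_inv_smul_flux_add_neg hI hΩ hf hfpos hmono hu huI hflux x₀ ?_ hx (hsuper x hxR)
    rwa [hk, div_mul_cancel₀ _ hN0.ne']

end Comparison

/-- Theorem 2.2, inequality (2.4): pointwise lower bound
`F(u(x)) ≥ ((p-1)/p) (ρ_x(d_Ω(x)) d_Ω(x)^p / N)^(1/(p-1))` for any `C¹` positive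
supersolution `u` of `-Δ_p u = ρ(x) f(u)` vanishing on `∂Ω`. -/
theorem stmt9 {N : ℕ} (hN : 1 ≤ N) (p : ℝ) (hp : 1 < p)
    (Ω : Set (EuclideanSpace ℝ (Fin N))) (hΩo : IsOpen Ω) (hΩb : Bornology.IsBounded Ω)
    (ρ : EuclideanSpace ℝ (Fin N) → ℝ)
    (hρ0 : ∀ x ∈ Ω, 0 ≤ ρ x) (hρb : BddAbove (ρ '' Ω))
    (af : EReal) (haf : 0 < af) (f : ℝ → ℝ)
    (hf0 : ∀ t : ℝ, 0 ≤ t → (t : EReal) < af → 0 ≤ f t)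
    (hfpos : ∀ t : ℝ, 0 < t → (t : EReal) < af → 0 < f t)
    (hmono : MonotoneOn f {t : ℝ | 0 ≤ t ∧ (t : EReal) < af})
    (hreg : ContDiffOn ℝ 1 f {t : ℝ | 0 ≤ t ∧ (t : EReal) < af})
    (hint : ∀ a : ℝ, 0 < a → (a : EReal) < af →
      IntegrableOn (fun s => f s ^ (-(1 / (p - 1)))) (Ioo 0 a))
    (F : ℝ → ℝ) (hF : F = fun t => ∫ s in (0:ℝ)..t, f s ^ (-(1 / (p - 1))))
    (u : EuclideanSpace ℝ (Fin N) → ℝ)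
    (huc : ContinuousOn u (closure Ω)) (hu1 : ContDiffOn ℝ 1 u Ω)
    (hurange : ∀ x ∈ Ω, 0 < u x ∧ ((u x : ℝ) : EReal) < af)
    (hubd : ∀ x ∈ frontier Ω, u x = 0)
    (hflux : ContDiffOn ℝ 1 (flux p u) Ω)
    (hsuper : ∀ x ∈ Ω, pdiv (flux p u) x ≤ -(ρ x * f (u x))) :
    ∀ x ∈ Ω,
      ((p - 1) / p) *
        (sInf (ρ '' ball x (infDist x Ωᶜ)) * infDist x Ωᶜ ^ p / (N : ℝ)) ^ (1 / (p - 1))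
        ≤ F (u x) := by
  intro x hx
  set d := infDist x Ωᶜ with hd
  set c := sInf (ρ '' ball x d) with hc
  set I : Set ℝ := {t : ℝ | 0 < t ∧ (t : EReal) < af} with hIdef
  have hI : IsOpen I :=
    isOpen_Ioi.inter (isOpen_Iio.preimage continuous_coe_real_ereal)
  have hsub : I ⊆ {t : ℝ | 0 ≤ t ∧ (t : EReal) < af} := fun t ht => ⟨ht.1.le, ht.2⟩
  have hballΩ : ball x d ⊆ Ω := ball_infDist_compl_subset
  have hf : ContDiffOn ℝ 1 f I := hreg.mono hsub
  have hpos : ∀ t ∈ I, 0 < f t := fun t ht => hfpos t ht.1 ht.2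
  have hF0 : ∀ t ∈ I, 0 ≤ F t := fun t ht => by
    rw [hF]
    refine intervalIntegral.integral_nonneg ht.1.le fun s hs => Real.rpow_nonneg (hf0 s hs.1 ?_) _
    exact (EReal.coe_le_coe_iff.2 hs.2).trans_lt ht.2
  have hcont : ContinuousOn (fun s => f s ^ (-(1 / (p - 1)))) I :=
    hf.continuousOn.rpow_const fun t ht => Or.inl (hpos t ht).ne'
  have hFd : ∀ t ∈ I, HasDerivAt F (f t ^ (-(1 / (p - 1)))) t := fun t ht => by
    rw [hF]
    refine intervalIntegral.integral_hasDerivAt_right ?_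
      (hcont.stronglyMeasurableAtFilter hI t ht) (hcont.continuousAt (hI.mem_nhds ht))
    rw [intervalIntegrable_iff_integrableOn_Ioo_of_le ht.1.le]
    exact hint t ht.1 ht.2
  have hFx := hF0 _ (hurange x hx)
  have hp1 : 0 < p - 1 := by linarith
  have hexp : (p - 1)⁻¹ ≠ 0 := (inv_pos.2 hp1).ne'
  have hd0 : 0 ≤ d := infDist_nonneg
  have hlow : ∀ y ∈ ball x d, c ≤ ρ y := fun y hy =>
    csInf_le ⟨0, by rintro _ ⟨z, hz, rfl⟩; exact hρ0 z (hballΩ hz)⟩ (mem_image_of_mem _ hy)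
  have hc0 : 0 ≤ c := Real.sInf_nonneg (by rintro _ ⟨z, hz, rfl⟩; exact hρ0 z (hballΩ hz))
  rcases hd0.eq_or_lt with hd' | hd'
  · simpa [← hd', Real.zero_rpow (by linarith : p ≠ 0), Real.zero_rpow hexp] using hFx
  rcases hc0.eq_or_lt with hc' | hc'
  · simpa [← hc', Real.zero_rpow hexp] using hFx
  have hlim : Filter.Tendsto
      (fun t : ℝ => (p - 1) / p * (t * c * (t * d) ^ p / N) ^ (1 / (p - 1))) (nhdsWithin 1 (Iio 1))
      (nhds ((p - 1) / p * (c * d ^ p / N) ^ (1 / (p - 1)))) := by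
    have hct : Continuous
        fun t : ℝ => (p - 1) / p * (t * c * (t * d) ^ p / N) ^ (1 / (p - 1)) :=
      continuous_const.mul ((((continuous_id.mul continuous_const).mul
        ((continuous_id.mul continuous_const).rpow_const fun _ => Or.inr (by linarith))).div_const
          _).rpow_const fun _ => Or.inr (by positivity))
    simpa using (hct.tendsto 1).mono_left nhdsWithin_le_nhds
  refine le_of_tendsto hlim ?_
  filter_upwards [Ioo_mem_nhdsLT (zero_lt_one' ℝ)] with t ht
  have hball : closedBall x (t * d) ⊆ ball x d :=
    closedBall_subset_ball (by nlinarith [ht.2])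
  refine radial_le_comp_of_pdiv_flux_le (c := c) hN hp hI hΩo hf hpos (hmono.mono hsub) hFd hF0 hu1
    hurange hflux (mul_nonneg ht.1.le hd0) (hball.trans hballΩ) (mul_nonneg ht.1.le hc0)
    (by nlinarith [ht.2]) fun y hy => (hsuper y (hballΩ (hball hy))).trans ?_
  exact neg_le_neg (mul_le_mul_of_nonneg_right (hlow y (hball hy))
    (hpos _ (hurange y (hballΩ (hball hy)))).le)
end
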